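/- Let F be a field of characteristic p > 0, let h ∈ F[x], and let δ : F[x] → F[x] be the unique F-derivation with δ(x) = h (so δ(f) = f'·h). Then δ^p(x) = −(h^{p−1})^{(p−1)} · h, where (h^{p−1})^{(p−1)} denotes the (p−1)-st formal derivative of h^{p−1}. -/

import Mathlib

open Polynomial

/-- The `p`-th power of `f ↦ f' h` satisfies the Leibniz rule. -/
lemma aux_leib {F : Type*} [Field F] (p : ℕ) (hp : p.Prime) [CharP F p]
    (h : F[X]) (δ : F[X] → F[X]) (hδ : ∀ f, δ f = derivative f * h) (f g : F[X]) :
    δ^[p] (f * g) = δ^[p] f * g + f * δ^[p] g := by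
  have := Fact.mk hp
  have key : ∀ n : ℕ, δ^[n] (f * g) =
      ∑ k ∈ Finset.range (n + 1), (n.choose k : F[X]) * (δ^[k] f * δ^[n - k] g) := by
    have hz : ∀ a b, δ (a * b) = δ a * b + a * δ b := by
      intro a b; simp only [hδ, derivative_mul]; ring
    have hs : ∀ (s : Finset (ℕ × ℕ)) (v : ℕ × ℕ → F[X]), δ (∑ i ∈ s, v i) = ∑ i ∈ s, δ (v i) := by
      intro s v; simp only [hδ, derivative_sum, Finset.sum_mul]
    have hn : ∀ (n : ℕ) a, δ ((n : F[X]) * a) = n * δ a := by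
      intro n a; simp only [hδ, derivative_mul, derivative_natCast]; ring
    intro n
    rw [← Finset.Nat.sum_antidiagonal_eq_sum_range_succ
      (fun i j => (n.choose i : F[X]) * (δ^[i] f * δ^[j] g))]
    induction n with
    | zero => simp
    | succ n ih =>
      rw [Function.iterate_succ_apply', ih, hs,
        Finset.sum_antidiagonal_choose_succ_mul (fun i j => δ^[i] f * δ^[j] g),
        ← Finset.sum_add_distrib]
      refine Finset.sum_congr rfl fun x hx => ?_
      have : n.choose x.2 = n.choose x.1 := by
        rw [Finset.HasAntidiagonal.mem_antidiagonal] at hx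
        exact (Nat.choose_symm_of_eq_add (by omega)).symm
      rw [hn, hz]
      simp only [Function.iterate_succ_apply']
      try rw [this]
      ring
  rw [key, Finset.sum_range_succ, Finset.sum_eq_single 0]
  · simp; ring
  · intro k hk hk0
    rw [Finset.mem_range] at hk
    have : ((p.choose k : ℕ) : F[X]) = 0 :=
      (CharP.cast_eq_zero_iff F[X] p _).2 (hp.dvd_choose_self hk0 hk)
    rw [this, zero_mul]
  · intro h0; exact absurd (Finset.mem_range.2 hp.pos) h0

lemma aux_pow {F : Type*} [Field F] (p : ℕ) (hp : p.Prime) [CharP F p]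
    (h : F[X]) (δ : F[X] → F[X]) (hδ : ∀ f, δ f = derivative f * h) (n : ℕ) :
    δ^[p] (X ^ n) = δ^[p] X * derivative (X ^ n) := by
  induction n with
  | zero =>
    have := aux_leib p hp h δ hδ 1 1
    simp only [mul_one, one_mul] at this
    simpa using this
  | succ n ih =>
    rw [pow_succ, aux_leib p hp h δ hδ, ih, derivative_mul, derivative_X]; ring

/-- Normal form of `u ↦ δ^m (h u)` as a differential operator. -/
lemma aux_op {F : Type*} [Field F]
    (h : F[X]) (δ : F[X] → F[X]) (hδ : ∀ f, δ f = derivative f * h) (m : ℕ) :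
    ∃ a : ℕ → F[X], a m = h ^ (m + 1) ∧ (∀ k, m < k → a k = 0) ∧
      ∀ u, δ^[m] (h * u) = ∑ k ∈ Finset.range (m + 1), a k * derivative^[k] u := by
  induction m with
  | zero =>
    refine ⟨fun k => if k = 0 then h else 0, by simp, ?_, by simp⟩
    intro k hk; simp [hk.ne']
  | succ m ih =>
    obtain ⟨a, h1, h2, h3⟩ := ih
    refine ⟨fun k => h * derivative (a k) + (if k = 0 then 0 else h * a (k - 1)), ?_, ?_, ?_⟩
    · simp [h2 (m + 1) (by omega), h1]; ring
    · intro k hk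
      simp [h2 k (by omega), h2 (k - 1) (by omega)]
    · intro u
      rw [Function.iterate_succ_apply', h3, hδ, derivative_sum]
      simp only [add_mul, Finset.sum_add_distrib]
      have e1 : ∑ k ∈ Finset.range (m + 1 + 1), h * derivative (a k) * derivative^[k] u =
          ∑ k ∈ Finset.range (m + 1), h * derivative (a k) * derivative^[k] u := by
        rw [Finset.sum_range_succ, h2 (m + 1) (by omega), derivative_zero, mul_zero, zero_mul,
          add_zero]
      have e2 : ∑ k ∈ Finset.range (m + 1 + 1),
          (if k = 0 then 0 else h * a (k - 1)) * derivative^[k] u =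
          ∑ k ∈ Finset.range (m + 1), h * a k * derivative^[k + 1] u := by
        rw [Finset.sum_range_succ', if_pos rfl, zero_mul, add_zero]
        exact Finset.sum_congr rfl fun x _ => by
          rw [if_neg (Nat.succ_ne_zero x), Nat.add_sub_cancel]
      rw [e1, e2, ← Finset.sum_add_distrib, Finset.sum_mul]
      refine Finset.sum_congr rfl fun x _ => ?_
      rw [derivative_mul, Function.iterate_succ_apply']
      ring

/-- In characteristic `p > 0`, for the derivation `δ(f) = f'·h` of `F[x]`
one has `δ^p(x) = −(h^{p−1})^{(p−1)} · h`. -/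
theorem stmt7 {F : Type*} [Field F] (p : ℕ) (hp : p.Prime) [CharP F p]
    (h : F[X]) (δ : F[X] → F[X]) (hδ : ∀ f, δ f = derivative f * h) :
    δ^[p] X = -(derivative^[p - 1] (h ^ (p - 1))) * h := by
  obtain ⟨m, rfl⟩ : ∃ m, p = m + 1 := ⟨p - 1, by have := hp.pos; omega⟩
  have hm : 0 < m := by have := hp.two_le; omega
  simp only [Nat.add_sub_cancel]
  obtain ⟨a, h1, -, h3⟩ := aux_op h δ hδ m
  have hc : ∀ f, δ^[m + 1] f = ∑ k ∈ Finset.range (m + 1), a k * derivative^[k + 1] f := by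
    intro f
    rw [Function.iterate_succ_apply, hδ, mul_comm, h3]
    simp [Function.iterate_succ_apply]
  have ha0 : δ^[m + 1] X = a 0 := by
    rw [hc, Finset.sum_range_succ']
    simp [Function.iterate_succ_apply]
  have hak : ∀ k, 0 < k → k < m → a k = 0 := by
    intro k
    induction k using Nat.strong_induction_on with
    | _ k ih =>
      intro hk hkm
      have e := aux_pow (m + 1) hp h δ hδ (k + 1)
      rw [ha0, hc, ← Finset.sum_subset (s₁ := {0, k})] at e
      · rw [Finset.sum_pair hk.ne] at e
        simp only [zero_add, Function.iterate_one, add_eq_left] at e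
        rw [iterate_derivative_X_pow_eq_natCast_mul, Nat.descFactorial_self] at e
        rcases mul_eq_zero.1 e with e | e
        · exact e
        · exfalso
          rw [Nat.sub_self, pow_zero, mul_one, CharP.cast_eq_zero_iff F[X] (m + 1),
            hp.dvd_factorial] at e
          omega
      · intro x hx
        simp only [Finset.mem_insert, Finset.mem_singleton] at hx
        rw [Finset.mem_range]; omega
      · intro x hx hx'
        simp only [Finset.mem_insert, Finset.mem_singleton, not_or] at hx'
        rw [Finset.mem_range] at hx
        rcases lt_or_gt_of_ne hx'.2 with hl | hl
        · rw [ih x hl (by omega) (by omega), zero_mul]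
        · rw [iterate_derivative_eq_zero, mul_zero]
          rw [natDegree_X_pow]; omega
  by_cases hh : h = 0
  · rw [hh, mul_zero, Function.iterate_succ_apply', hδ, hh, mul_zero]
  have e := h3 (h ^ m)
  have hz : δ^[m] (h * h ^ m) = 0 := by
    have h0 : δ 0 = 0 := by simp [hδ]
    have h00 : δ (h ^ (m + 1)) = 0 := by
      rw [hδ, derivative_pow, CharP.cast_eq_zero F (m + 1)]; simp
    obtain ⟨j, rfl⟩ : ∃ j, m = j + 1 := ⟨m - 1, by omega⟩
    rw [← pow_succ', Function.iterate_succ_apply, h00]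
    exact Function.iterate_fixed h0 j
  rw [hz, ← Finset.sum_subset (s₁ := {0, m}), Finset.sum_pair hm.ne, h1] at e
  · rw [ha0]
    have : h ^ m ≠ 0 := pow_ne_zero _ hh
    apply mul_right_cancel₀ this
    simp only [Function.iterate_zero, id] at e
    linear_combination -e
  · intro x hx
    simp only [Finset.mem_insert, Finset.mem_singleton] at hx
    rw [Finset.mem_range]; omega
  · intro x hx hx'
    simp only [Finset.mem_insert, Finset.mem_singleton, not_or] at hx'
    rw [Finset.mem_range] at hx
    rw [hak x (by omega) (by omega), zero_mul]
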